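/- arXiv:1801.00380 — 2 statements merged into one kernel-verified Lean document; each statement's English description precedes it below -/
import Mathlib

section
/- Under the hypotheses of the previous monotonicity lemma (ADMM iterates (Σⁱ, Φⁱ, Λⁱ) with updates Φ^{i+1} = (Σⁱ + τΛⁱ)₊, Σ^{i+1} = s(τ(Σ̄ − Λⁱ) + Φ^{i+1}, λτ)/(τ + 1), Λ^{i+1} = Λⁱ − (1/τ)(Φ^{i+1} − Σ^{i+1}), and existence of a KKT point (Σ̂⁺, Φ̂⁺, Λ̂⁺) as described there), the differences of successive iterates vanish: ‖Σⁱ − Σ^{i+1}‖_F → 0, ‖Λⁱ − Λ^{i+1}‖_F → 0, and ‖Φⁱ − Σⁱ‖_F → 0 as i → ∞; moreover the sequence ‖W⁺ − Wⁱ‖²_J is non-increasing in i, so the iterates (Λⁱ, Σⁱ) remain in a bounded set. -/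
open Matrix Filter Topology

/-- The Frobenius norm of a real `p × p` matrix. -/
noncomputable def frobNorm {p : ℕ} (A : Matrix (Fin p) (Fin p) ℝ) : ℝ :=
  Real.sqrt (∑ i, ∑ j, (A i j) ^ 2)

/-- The L1 norm of the off-diagonal entries: `|Σ|₁ = ∑_{i ≠ j} |σ_{ij}|`. -/
noncomputable def offDiagL1 {p : ℕ} (A : Matrix (Fin p) (Fin p) ℝ) : ℝ :=
  ∑ i, ∑ j, if i = j then 0 else |A i j|

/-- The trace inner product `⟨A, B⟩ = ∑ i j, A i j * B i j`. -/
def matInner {p : ℕ} (A B : Matrix (Fin p) (Fin p) ℝ) : ℝ :=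
  ∑ i, ∑ j, A i j * B i j

/-- The elementwise soft-threshold operator: off the diagonal
`s(z, δ) = sign(z) * max(|z| − δ, 0)`, and the diagonal is left unchanged. -/
noncomputable def softThresh {p : ℕ} (Z : Matrix (Fin p) (Fin p) ℝ) (δ : ℝ) :
    Matrix (Fin p) (Fin p) ℝ :=
  Matrix.of fun i j =>
    if i = j then Z i j else Real.sign (Z i j) * max (|Z i j| - δ) 0

/-- `IsClip ν Z W` says that `W = (Z)₊`: there is an orthonormal spectral decomposition
`Z = ∑ i, lam i • ξ i (ξ i)ᵀ` such that `W = ∑ i, max (lam i) ν • ξ i (ξ i)ᵀ`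
(the eigenvalue-clipping of `Z` at level `ν`). -/
def IsClip {p : ℕ} (ν : ℝ) (Z W : Matrix (Fin p) (Fin p) ℝ) : Prop :=
  ∃ (lam : Fin p → ℝ) (ξ : Fin p → (Fin p → ℝ)),
    (∀ i j : Fin p, ξ i ⬝ᵥ ξ j = if i = j then (1 : ℝ) else 0) ∧
    Z = ∑ i, lam i • Matrix.vecMulVec (ξ i) (ξ i) ∧
    W = ∑ i, max (lam i) ν • Matrix.vecMulVec (ξ i) (ξ i)

/-- The squared `J`-norm of a pair `(Λ, Σ)`: `‖(Λ, Σ)‖²_J = τ‖Λ‖²_F + τ⁻¹‖Σ‖²_F`. -/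
noncomputable def JnormSq {p : ℕ} (τ : ℝ) (L S : Matrix (Fin p) (Fin p) ℝ) : ℝ :=
  τ * (frobNorm L) ^ 2 + τ⁻¹ * (frobNorm S) ^ 2

/-- Scalar subgradient condition for `l * |x|`. -/
def SubG (l x g : ℝ) : Prop := g * x = l * |x| ∧ |g| ≤ l

theorem SubG.mono {l x g y h : ℝ} (h1 : SubG l x g) (h2 : SubG l y h) :
    0 ≤ (g - h) * (x - y) := by
  obtain ⟨a1, a2⟩ := h1
  obtain ⟨b1, b2⟩ := h2
  have c1 : g * y ≤ l * |y| := by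
    calc g * y ≤ |g * y| := le_abs_self _
      _ = |g| * |y| := abs_mul _ _
      _ ≤ l * |y| := by gcongr
  have c2 : h * x ≤ l * |x| := by
    calc h * x ≤ |h * x| := le_abs_self _
      _ = |h| * |x| := abs_mul _ _
      _ ≤ l * |x| := by gcongr
  nlinarith

theorem subG_sign {l x : ℝ} (hl : 0 ≤ l) (hx : x ≠ 0) : SubG l x (l * Real.sign x) := by
  rcases lt_or_gt_of_ne hx with h | h
  · rw [Real.sign_of_neg h]
    refine ⟨by rw [abs_of_neg h]; ring, by rw [mul_neg, mul_one, abs_neg, abs_of_nonneg hl]⟩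
  · rw [Real.sign_of_pos h]
    refine ⟨by rw [abs_of_pos h]; ring, by rw [mul_one, abs_of_nonneg hl]⟩

theorem subG_soft {d z : ℝ} (hd : 0 ≤ d) :
    SubG d (Real.sign z * max (|z| - d) 0) (z - Real.sign z * max (|z| - d) 0) := by
  rcases lt_trichotomy z 0 with h | h | h
  · rw [Real.sign_of_neg h, abs_of_neg h]
    rcases le_total (-z - d) 0 with h2 | h2
    · rw [max_eq_right h2]
      exact ⟨by simp, by rw [abs_le]; constructor <;> linarith⟩
    · rw [max_eq_left h2]
      refine ⟨by rw [abs_of_nonpos (by linarith)]; ring, by rw [abs_le]; constructor <;> linarith⟩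
  · subst h
    simp [SubG, hd]
  · rw [Real.sign_of_pos h, abs_of_pos h]
    rcases le_total (z - d) 0 with h2 | h2
    · rw [max_eq_right h2]
      exact ⟨by simp, by rw [abs_le]; constructor <;> linarith⟩
    · rw [max_eq_left h2]
      refine ⟨by rw [abs_of_nonneg (by linarith)]; ring, by rw [abs_le]; constructor <;> linarith⟩

theorem SubG.scale {l t c x g : ℝ} (ht : 0 < t) (hc : 0 < c) (h : SubG (l * t) (c * x) (t * g)) :
    SubG l x g := by
  obtain ⟨a, b⟩ := h
  rw [abs_mul, abs_of_pos hc] at a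
  rw [abs_mul, abs_of_pos ht] at b
  constructor
  · have : (t * c) * (g * x) = (t * c) * (l * |x|) := by linarith
    exact mul_left_cancel₀ (by positivity) this
  · nlinarith

/-- The one-step scalar inequality. -/
theorem scalar_step {t a0 a b0 b : ℝ} (ht : 0 < t) (h1 : b ^ 2 ≤ - a * b)
    (h2 : (b0 - b) ^ 2 ≤ - ((a0 - a) * (b0 - b))) :
    (t * (a0 - a) ^ 2 + t⁻¹ * (b0 - b) ^ 2) + (t * a ^ 2 + t⁻¹ * b ^ 2)
      + 2 * t⁻¹ * -((t * a + b0 - b) * (-b - t * (a0 - a))) ≤ t * a0 ^ 2 + t⁻¹ * b0 ^ 2 := by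
  have hi : t⁻¹ * t = 1 := inv_mul_cancel₀ ht.ne'
  have e : t * a0 ^ 2 + t⁻¹ * b0 ^ 2 - ((t * (a0 - a) ^ 2 + t⁻¹ * (b0 - b) ^ 2) + (t * a ^ 2 + t⁻¹ * b ^ 2)
      + 2 * t⁻¹ * -((t * a + b0 - b) * (-b - t * (a0 - a)))) =
      2 * (-a * b) + 2 * (-((a0 - a) * (b0 - b))) := by
    field_simp
    ring
  nlinarith [sq_nonneg b, sq_nonneg (b0 - b)]

theorem matInner_vecMulVec {p : ℕ} (x : Fin p → ℝ) (X : Matrix (Fin p) (Fin p) ℝ) :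
    matInner (Matrix.vecMulVec x x) X = x ⬝ᵥ (X *ᵥ x) := by
  simp only [matInner, Matrix.vecMulVec_apply, dotProduct, Matrix.mulVec, Finset.mul_sum]
  refine Finset.sum_congr rfl fun i _ => Finset.sum_congr rfl fun j _ => by ring

theorem matInner_sum_left {p : ℕ} (c : Fin p → ℝ) (A : Fin p → Matrix (Fin p) (Fin p) ℝ)
    (X : Matrix (Fin p) (Fin p) ℝ) :
    matInner (∑ k, c k • A k) X = ∑ k, c k * matInner (A k) X := by
  simp only [matInner, Matrix.sum_apply, Matrix.smul_apply, smul_eq_mul, Finset.sum_mul,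
    Finset.mul_sum]
  rw [Finset.sum_congr rfl fun i _ => Finset.sum_comm, Finset.sum_comm]
  refine Finset.sum_congr rfl fun i _ => Finset.sum_congr rfl fun j _ =>
    Finset.sum_congr rfl fun k _ => by ring

theorem orth_sum {p : ℕ} (ξ : Fin p → (Fin p → ℝ))
    (h : ∀ i j : Fin p, ξ i ⬝ᵥ ξ j = if i = j then (1 : ℝ) else 0) :
    ∑ k, Matrix.vecMulVec (ξ k) (ξ k) = (1 : Matrix (Fin p) (Fin p) ℝ) := by
  have h1 : (Matrix.of ξ) * (Matrix.of ξ)ᵀ = 1 := by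
    ext i j
    rw [Matrix.mul_apply, Matrix.one_apply, ← h i j]
    rfl
  have h2 := mul_eq_one_comm.mp h1
  rw [← h2]
  ext i j
  simp [Matrix.sum_apply, Matrix.vecMulVec_apply, Matrix.mul_apply]

theorem clip_psd {p : ℕ} {ν : ℝ} {Z W : Matrix (Fin p) (Fin p) ℝ} (h : IsClip ν Z W) :
    (W - ν • (1 : Matrix (Fin p) (Fin p) ℝ)).PosSemidef := by
  obtain ⟨l, ξ, ho, -, rfl⟩ := h
  rw [← orth_sum ξ ho, Finset.smul_sum, ← Finset.sum_sub_distrib]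
  refine Matrix.posSemidef_sum _ fun k _ => ?_
  rw [← sub_smul]
  refine Matrix.PosSemidef.smul ?_ (by linarith [le_max_right (l k) ν])
  simpa using Matrix.posSemidef_vecMulVec_self_star (ξ k)

theorem clip_proj {p : ℕ} {ν : ℝ} {Z W X : Matrix (Fin p) (Fin p) ℝ} (h : IsClip ν Z W)
    (hX : (X - ν • (1 : Matrix (Fin p) (Fin p) ℝ)).PosSemidef) :
    matInner (Z - W) (X - W) ≤ 0 := by
  obtain ⟨l, ξ, ho, hZ, hW⟩ := h
  have hZW : Z - W = ∑ k, (l k - max (l k) ν) • Matrix.vecMulVec (ξ k) (ξ k) := by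
    rw [hZ, hW, ← Finset.sum_sub_distrib]
    exact Finset.sum_congr rfl fun k _ => (sub_smul _ _ _).symm
  rw [hZW, matInner_sum_left]
  refine Finset.sum_nonpos fun k _ => ?_
  rw [matInner_vecMulVec]
  rcases le_total ν (l k) with hk | hk
  · rw [max_eq_left hk]; simp
  · have hWk : W *ᵥ ξ k = ν • ξ k := by
      rw [hW, Matrix.sum_mulVec]
      rw [Finset.sum_eq_single k]
      · rw [Matrix.smul_mulVec, Matrix.vecMulVec_mulVec, ho]
        simp [max_eq_right hk]
      · intro b _ hb
        rw [Matrix.smul_mulVec, Matrix.vecMulVec_mulVec, ho]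
        simp [hb]
      · simp
    have hx := hX.dotProduct_mulVec_nonneg (ξ k)
    rw [Matrix.sub_mulVec, Matrix.smul_mulVec, Matrix.one_mulVec] at hx
    rw [max_eq_right hk, Matrix.sub_mulVec, hWk]
    exact mul_nonpos_of_nonpos_of_nonneg (by linarith) (by simpa using hx)

theorem frob_sq {p : ℕ} (A : Matrix (Fin p) (Fin p) ℝ) :
    frobNorm A ^ 2 = ∑ i, ∑ j, (A i j) ^ 2 :=
  Real.sq_sqrt (Finset.sum_nonneg fun _ _ => Finset.sum_nonneg fun _ _ => sq_nonneg _)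

theorem frob_nonneg {p : ℕ} (A : Matrix (Fin p) (Fin p) ℝ) : 0 ≤ frobNorm A := Real.sqrt_nonneg _

theorem jnorm_eq {p : ℕ} (τ : ℝ) (L S : Matrix (Fin p) (Fin p) ℝ) :
    JnormSq τ L S = ∑ i, ∑ j, (τ * (L i j) ^ 2 + τ⁻¹ * (S i j) ^ 2) := by
  simp only [JnormSq, frob_sq, Finset.sum_add_distrib, Finset.mul_sum]

theorem frob_sub_comm {p : ℕ} (A B : Matrix (Fin p) (Fin p) ℝ) :
    frobNorm (A - B) = frobNorm (B - A) := by
  unfold frobNorm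
  congr 1
  refine Finset.sum_congr rfl fun i _ => Finset.sum_congr rfl fun j _ => ?_
  simp only [Matrix.sub_apply]; ring

theorem frob_bound {p : ℕ} (A B : Matrix (Fin p) (Fin p) ℝ) :
    frobNorm B ^ 2 ≤ 2 * frobNorm A ^ 2 + 2 * frobNorm (A - B) ^ 2 := by
  simp only [frob_sq, Finset.mul_sum, ← Finset.sum_add_distrib]
  refine Finset.sum_le_sum fun i _ => Finset.sum_le_sum fun j _ => ?_
  simp only [Matrix.sub_apply]
  nlinarith [sq_nonneg (2 * A i j - B i j)]

/-- Under the hypotheses of the ADMM monotonicity lemma (ADMM iterates plus the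
existence of a KKT point), successive differences vanish:
`‖Σⁱ − Σ^{i+1}‖_F → 0`, `‖Λⁱ − Λ^{i+1}‖_F → 0`, `‖Φⁱ − Σⁱ‖_F → 0`; moreover
`‖W⁺ − Wⁱ‖²_J` is non-increasing, so the iterates `(Λⁱ, Σⁱ)` remain bounded. -/
theorem admm_differences_vanish {p M : ℕ} (hM : 0 < M)
    (lam ν τ : ℝ) (hlam : 0 ≤ lam) (hν : 0 < ν) (hτ : 0 < τ)
    (Sighat : Fin M → Matrix (Fin p) (Fin p) ℝ) (hsymm : ∀ k, (Sighat k).IsSymm)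
    (Sig Phi Lam : ℕ → Matrix (Fin p) (Fin p) ℝ)
    (hseq : ∀ i, (Sig i).IsSymm ∧ (Phi i).IsSymm ∧ (Lam i).IsSymm)
    (hPhiStep : ∀ i, IsClip ν (Sig i + τ • Lam i) (Phi (i + 1)))
    (hSigStep : ∀ i, Sig (i + 1) = (τ + 1)⁻¹ •
      softThresh (τ • ((M : ℝ)⁻¹ • ∑ k, Sighat k - Lam i) + Phi (i + 1)) (lam * τ))
    (hLamStep : ∀ i, Lam (i + 1) = Lam i - τ⁻¹ • (Phi (i + 1) - Sig (i + 1)))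
    -- the KKT point `(Σ̂⁺, Φ̂⁺, Λ̂⁺)`
    (Sigp Phip Lamp : Matrix (Fin p) (Fin p) ℝ)
    (hSigpSymm : Sigp.IsSymm) (hPhipSymm : Phip.IsSymm) (hLampSymm : Lamp.IsSymm)
    (hPrimal : Phip = Sigp)
    (hFeas : (Phip - ν • (1 : Matrix (Fin p) (Fin p) ℝ)).PosSemidef)
    (hDual : ∀ Φ : Matrix (Fin p) (Fin p) ℝ, Φ.IsSymm →
      (Φ - ν • (1 : Matrix (Fin p) (Fin p) ℝ)).PosSemidef → matInner Lamp (Φ - Phip) ≤ 0)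
    (hStatDiag : ∀ j : Fin p, (Sigp - (M : ℝ)⁻¹ • ∑ k, Sighat k) j j + Lamp j j = 0)
    (hStatOff : ∀ j l : Fin p, j ≠ l →
      if Sigp j l ≠ 0 then
        (-Sigp + (M : ℝ)⁻¹ • ∑ k, Sighat k - Lamp) j l = lam * Real.sign (Sigp j l)
      else |(-Sigp + (M : ℝ)⁻¹ • ∑ k, Sighat k - Lamp) j l| ≤ lam) :
    Tendsto (fun i => frobNorm (Sig i - Sig (i + 1))) atTop (nhds 0) ∧
    Tendsto (fun i => frobNorm (Lam i - Lam (i + 1))) atTop (nhds 0) ∧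
    Tendsto (fun i => frobNorm (Phi i - Sig i)) atTop (nhds 0) ∧
    (∀ i, 1 ≤ i →
      JnormSq τ (Lamp - Lam (i + 1)) (Sigp - Sig (i + 1)) ≤
        JnormSq τ (Lamp - Lam i) (Sigp - Sig i)) ∧
    (∃ C : ℝ, ∀ i, frobNorm (Lam i) ≤ C ∧ frobNorm (Sig i) ≤ C) := by
  subst hPrimal
  set Sb := (M : ℝ)⁻¹ • ∑ k, Sighat k with hSb
  have hsg : ∀ i j l, SubG (if j = l then 0 else lam) (Sig (i+1) j l)
      ((Sb - Lam (i+1) - Sig (i+1)) j l) := by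
    intro i j l
    have ht1 : 0 < τ + 1 := by linarith
    have hx : (τ + 1) * Sig (i+1) j l =
        softThresh (τ • (Sb - Lam i) + Phi (i + 1)) (lam * τ) j l := by
      conv_lhs => rw [hSigStep i]
      rw [Matrix.smul_apply, smul_eq_mul, mul_inv_cancel_left₀ ht1.ne']
    have hg : τ * (Sb - Lam (i+1) - Sig (i+1)) j l =
        (τ • (Sb - Lam i) + Phi (i + 1)) j l - (τ + 1) * Sig (i+1) j l := by
      have : Lam (i+1) j l = Lam i j l - τ⁻¹ * (Phi (i+1) j l - Sig (i+1) j l) := by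
        rw [hLamStep i]; simp
      simp only [Matrix.sub_apply, Matrix.add_apply, Matrix.smul_apply, smul_eq_mul, this]
      field_simp
      ring
    refine SubG.scale hτ ht1 ?_
    rw [hg, hx]
    by_cases h : j = l
    · simp [softThresh, h, SubG]
    · simp only [softThresh, Matrix.of_apply, h, if_false]
      exact subG_soft (by positivity)
  have hsp : ∀ j l, SubG (if j = l then 0 else lam) (Phip j l) ((Sb - Lamp - Phip) j l) := by
    intro j l
    by_cases h : j = l
    · subst h
      have := hStatDiag j
      simp only [Matrix.sub_apply] at this
      have h0 : (Sb - Lamp - Phip) j j = 0 := by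
        simp only [Matrix.sub_apply]; linarith
      rw [h0]; simp [SubG]
    · have := hStatOff j l h
      have e : (-Phip + Sb - Lamp) j l = (Sb - Lamp - Phip) j l := by
        simp only [Matrix.sub_apply, Matrix.add_apply, Matrix.neg_apply]; ring
      rw [e] at this
      rw [if_neg h]
      by_cases h0 : Phip j l = 0
      · simp only [h0, ne_eq, not_true_eq_false, if_false] at this
        exact ⟨by simp [h0], this⟩
      · rw [if_pos h0] at this
        rw [this]
        exact subG_sign hlam h0
  -- one step
  have hstep : ∀ i, 1 ≤ i →
      JnormSq τ (Lam i - Lam (i + 1)) (Sig i - Sig (i + 1)) +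
      JnormSq τ (Lamp - Lam (i + 1)) (Phip - Sig (i + 1)) ≤
        JnormSq τ (Lamp - Lam i) (Phip - Sig i) := by
    intro i hi
    obtain ⟨k, rfl⟩ : ∃ k, i = k + 1 := ⟨i - 1, by omega⟩
    have hA := clip_proj (hPhiStep (k+1)) hFeas
    have hB := hDual (Phi (k+1+1)) (hseq _).2.1 (clip_psd (hPhiStep (k+1)))
    have hAB : 0 ≤ 2 * τ⁻¹ * -(matInner (Sig (k+1) + τ • Lam (k+1) - Phi (k+1+1)) (Phip - Phi (k+1+1))
        + τ * matInner Lamp (Phi (k+1+1) - Phip)) := by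
      have : τ * matInner Lamp (Phi (k+1+1) - Phip) ≤ 0 :=
        mul_nonpos_of_nonneg_of_nonpos hτ.le hB
      have h2 : 0 ≤ 2 * τ⁻¹ := by positivity
      exact mul_nonneg h2 (by linarith)
    refine le_trans (le_add_of_nonneg_right hAB) ?_
    simp only [jnorm_eq, matInner]
    simp only [Finset.mul_sum, ← Finset.sum_add_distrib, ← Finset.sum_neg_distrib]
    refine Finset.sum_le_sum fun j _ => Finset.sum_le_sum fun l _ => ?_
    have m1 := (hsg (k+1) j l).mono (hsp j l)
    have m2 := (hsg k j l).mono (hsg (k+1) j l)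
    have hL : Phi (k+1+1) j l = Sig (k+1+1) j l + τ * (Lam (k+1) j l - Lam (k+1+1) j l) := by
      rw [hLamStep (k+1)]
      simp only [Matrix.sub_apply, Matrix.smul_apply, smul_eq_mul]
      field_simp
      ring
    simp only [Matrix.sub_apply, Matrix.add_apply, Matrix.smul_apply, smul_eq_mul] at m1 m2 ⊢
    rw [hL]
    have := scalar_step (t := τ) (a0 := Lam (k+1) j l - Lamp j l) (a := Lam (k+1+1) j l - Lamp j l)
      (b0 := Sig (k+1) j l - Phip j l) (b := Sig (k+1+1) j l - Phip j l) hτ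
      (by nlinarith) (by nlinarith)
    refine le_trans (le_of_eq ?_) (this.trans (le_of_eq ?_)) <;> ring
  have hJ0 : ∀ L S : Matrix (Fin p) (Fin p) ℝ, 0 ≤ JnormSq τ L S := fun L S => by
    unfold JnormSq; positivity
  have hmono : ∀ i, 1 ≤ i → JnormSq τ (Lamp - Lam (i + 1)) (Phip - Sig (i + 1)) ≤
        JnormSq τ (Lamp - Lam i) (Phip - Sig i) := fun i hi => by
    linarith [hstep i hi, hJ0 (Lam i - Lam (i + 1)) (Sig i - Sig (i + 1))]
  have hanti : Antitone fun n => JnormSq τ (Lamp - Lam (n + 1)) (Phip - Sig (n + 1)) :=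
    antitone_nat_of_succ_le fun n => hmono (n+1) (by omega)
  have hJlim : Tendsto (fun i => JnormSq τ (Lam i - Lam (i + 1)) (Sig i - Sig (i + 1)))
      atTop (nhds 0) := by
    rw [← tendsto_add_atTop_iff_nat 1]
    have hc := tendsto_atTop_ciInf hanti ⟨0, by rintro _ ⟨n, rfl⟩; exact hJ0 _ _⟩
    have hd := hc.sub ((tendsto_add_atTop_iff_nat 1).mpr hc)
    rw [sub_self] at hd
    refine squeeze_zero (fun n => hJ0 _ _) (fun n => ?_) hd
    have := hstep (n+1) (by omega)
    linarith
  have key : ∀ (c : ℝ) (F : ℕ → Matrix (Fin p) (Fin p) ℝ), 0 < c →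
      (∀ i, c * frobNorm (F i) ^ 2 ≤ JnormSq τ (Lam i - Lam (i + 1)) (Sig i - Sig (i + 1))) →
      Tendsto (fun i => frobNorm (F i)) atTop (nhds 0) := by
    intro c F hc hF
    have h2 : Tendsto (fun i => frobNorm (F i) ^ 2) atTop (nhds 0) := by
      have := hJlim.const_mul c⁻¹
      rw [mul_zero] at this
      refine squeeze_zero (fun _ => sq_nonneg _) (fun i => ?_) this
      rw [le_inv_mul_iff₀ hc]
      exact hF i
    have h3 := h2.sqrt
    simpa [Real.sqrt_sq (frob_nonneg _)] using h3
  have hτi : 0 < τ⁻¹ := inv_pos.mpr hτ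
  refine ⟨key τ⁻¹ _ hτi fun i => ?_, key τ _ hτ fun i => ?_, ?_, hmono, ?_⟩
  · unfold JnormSq
    exact le_add_of_nonneg_left (by positivity)
  · unfold JnormSq
    exact le_add_of_nonneg_right (by positivity)
  · rw [← tendsto_add_atTop_iff_nat 1]
    refine key τ⁻¹ _ hτi fun i => ?_
    have e : frobNorm (Phi (i+1) - Sig (i+1)) ^ 2 = τ ^ 2 * frobNorm (Lam i - Lam (i+1)) ^ 2 := by
      simp only [frob_sq, Finset.mul_sum]
      refine Finset.sum_congr rfl fun j _ => Finset.sum_congr rfl fun l _ => ?_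
      rw [hLamStep i]
      simp only [Matrix.sub_apply, Matrix.smul_apply, smul_eq_mul]
      field_simp
      ring
    have e2 : τ⁻¹ * frobNorm (Phi (i+1) - Sig (i+1)) ^ 2 = τ * frobNorm (Lam i - Lam (i+1)) ^ 2 := by
      rw [e]; field_simp
    rw [e2]
    unfold JnormSq
    exact le_add_of_nonneg_right (by positivity)
  · set J0 := JnormSq τ (Lamp - Lam 0) (Phip - Sig 0) with hJ0d
    set J1 := JnormSq τ (Lamp - Lam 1) (Phip - Sig 1) with hJ1d
    have hB : ∀ i, JnormSq τ (Lamp - Lam i) (Phip - Sig i) ≤ J0 + J1 := by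
      intro i
      rcases i with _ | n
      · linarith [hJ0 (Lamp - Lam 1) (Phip - Sig 1)]
      · have := hanti (Nat.zero_le n)
        simp only [Nat.zero_add] at this
        linarith [hJ0 (Lamp - Lam 0) (Phip - Sig 0)]
    have hsq : ∀ x : ℝ, 0 ≤ x → ∀ y, x ^ 2 ≤ y → x ≤ 1 + y := fun x hx y hy => by
      nlinarith [sq_nonneg (x - 1)]
    refine ⟨max (1 + (2 * frobNorm Lamp ^ 2 + 2 * (τ⁻¹ * (J0 + J1))))
      (1 + (2 * frobNorm Phip ^ 2 + 2 * (τ * (J0 + J1)))), fun i => ⟨?_, ?_⟩⟩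
    · refine le_max_of_le_left (hsq _ (frob_nonneg _) _ ((frob_bound Lamp (Lam i)).trans ?_))
      gcongr
      rw [le_inv_mul_iff₀ hτ]
      refine le_trans ?_ (hB i)
      unfold JnormSq
      exact le_add_of_nonneg_right (by positivity)
    · refine le_max_of_le_right (hsq _ (frob_nonneg _) _ ((frob_bound Phip (Sig i)).trans ?_))
      gcongr
      rw [← inv_mul_le_iff₀ hτ]
      refine le_trans ?_ (hB i)
      unfold JnormSq
      exact le_add_of_nonneg_left (by positivity)
end

section
/- Let Σ₀ be a real symmetric positive definite p×p matrix with smallest eigenvalue λ_min(Σ₀), let ε ∈ (0, λ_min(Σ₀)), let λ > 0, and let Σ̂₁, …, Σ̂_M be real symmetric p×p matrices such that |(Σ̂_k)_{ij} − (Σ₀)_{ij}| ≤ λ for all 1 ≤ i, j ≤ p and 1 ≤ k ≤ M. Let s₀ be the number of nonzero off-diagonal entries of Σ₀, and define F(Δ) = (1/(2M))Σ_{k=1}^M ‖Δ + Σ₀ − Σ̂_k‖²_F + λ|Δ + Σ₀|₁ for symmetric Δ. Then for every symmetric Δ with Δ + Σ₀ ⪰ εI, F(Δ) − F(0) ≥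 (1/2)‖Δ‖²_F − 2λ√(s₀ + p)·‖Δ‖_F. -/
open Matrix

/-- The number of nonzero off-diagonal entries of a real `p × p` matrix. -/
noncomputable def offDiagSupport {p : ℕ} (A : Matrix (Fin p) (Fin p) ℝ) : ℕ :=
  (Finset.univ.filter fun ij : Fin p × Fin p => ij.1 ≠ ij.2 ∧ A ij.1 ij.2 ≠ 0).card

theorem frobNorm_sq' {p : ℕ} (A : Matrix (Fin p) (Fin p) ℝ) :
    frobNorm A ^ 2 = ∑ x : Fin p × Fin p, (A x.1 x.2) ^ 2 := by
  unfold frobNorm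
  rw [Real.sq_sqrt (by positivity), Fintype.sum_prod_type]

theorem offDiagL1_eq' {p : ℕ} (A : Matrix (Fin p) (Fin p) ℝ) :
    offDiagL1 A = ∑ x : Fin p × Fin p, if x.1 = x.2 then 0 else |A x.1 x.2| := by
  unfold offDiagL1
  rw [Fintype.sum_prod_type]

noncomputable def suppSet {p : ℕ} (A : Matrix (Fin p) (Fin p) ℝ) : Finset (Fin p × Fin p) :=
  Finset.univ.filter fun x => x.1 = x.2 ∨ A x.1 x.2 ≠ 0

theorem card_suppSet {p : ℕ} (A : Matrix (Fin p) (Fin p) ℝ) :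
    (suppSet A).card ≤ offDiagSupport A + p := by
  have h : suppSet A ⊆ (Finset.univ.filter fun ij : Fin p × Fin p =>
      ij.1 ≠ ij.2 ∧ A ij.1 ij.2 ≠ 0) ∪ (Finset.univ.image fun i : Fin p => (i, i)) := by
    rintro ⟨i, j⟩ hx
    simp only [suppSet, Finset.mem_filter, Finset.mem_univ, true_and] at hx
    by_cases hij : i = j
    · subst hij; simp
    · simp [hij] at hx ⊢
      exact hx
  refine (Finset.card_le_card h).trans ((Finset.card_union_le _ _).trans ?_)
  unfold offDiagSupport
  have := Finset.card_image_le (s := (Finset.univ : Finset (Fin p))) (f := fun i => (i, i))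
  simp only [Finset.card_univ, Fintype.card_fin] at this
  omega

theorem sum_suppSet_le {p : ℕ} (A D : Matrix (Fin p) (Fin p) ℝ) :
    ∑ x ∈ suppSet A, |D x.1 x.2| ≤
      Real.sqrt ((offDiagSupport A : ℝ) + (p : ℝ)) * frobNorm D := by
  have h0 : 0 ≤ frobNorm D := Real.sqrt_nonneg _
  refine abs_le_of_sq_le_sq' ?_ (by positivity) |>.2
  rw [mul_pow, Real.sq_sqrt (by positivity), frobNorm_sq']
  refine (sq_sum_le_card_mul_sum_sq).trans ?_
  simp only [sq_abs]
  have hc : ((suppSet A).card : ℝ) ≤ (offDiagSupport A : ℝ) + p := by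
    exact_mod_cast card_suppSet A
  refine mul_le_mul hc ?_ (Finset.sum_nonneg fun _ _ => sq_nonneg _) (by positivity)
  exact Finset.sum_le_sum_of_subset_of_nonneg (Finset.subset_univ _) fun _ _ _ => sq_nonneg _

theorem one_term {p : ℕ} (S D H : Matrix (Fin p) (Fin p) ℝ) (lam : ℝ) (hlam : 0 < lam)
    (hc : ∀ i j, |H i j - S i j| ≤ lam) :
    frobNorm D ^ 2 - 4 * lam * ∑ x ∈ suppSet S, |D x.1 x.2| ≤
      frobNorm (D + S - H) ^ 2 - frobNorm (0 + S - H) ^ 2 +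
        2 * lam * (offDiagL1 (D + S) - offDiagL1 (0 + S)) := by
  simp only [frobNorm_sq', offDiagL1_eq']
  unfold suppSet
  rw [Finset.sum_filter, Finset.mul_sum, ← Finset.sum_sub_distrib, ← Finset.sum_sub_distrib,
    ← Finset.sum_sub_distrib, Finset.mul_sum, ← Finset.sum_add_distrib]
  apply Finset.sum_le_sum
  rintro ⟨i, j⟩ -
  simp only [Matrix.add_apply, Matrix.sub_apply, Matrix.zero_apply, zero_add]
  have h1 : D i j * (H i j - S i j) ≤ lam * |D i j| := by
    refine (le_abs_self _).trans ?_
    rw [abs_mul, mul_comm]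
    exact mul_le_mul_of_nonneg_right (hc i j) (abs_nonneg _)
  by_cases hij : i = j
  · have := mul_nonneg hlam.le (abs_nonneg (D i j))
    simp only [hij, true_or, if_true] at *
    nlinarith
  · by_cases hS : S i j = 0
    · simp only [hij, hS, ne_eq, not_true, or_self, if_false, add_zero, abs_zero] at *
      nlinarith
    · simp only [hij, hS, ne_eq, not_false_eq_true, or_true, if_true, if_false]
      have h2 : |S i j| - |D i j| ≤ |D i j + S i j| := by
        have := abs_sub (D i j + S i j) (D i j)
        rw [add_sub_cancel_left] at this
        linarith
      nlinarith [mul_le_mul_of_nonneg_left h2 hlam.le]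

/-- Let `Sig0` be symmetric positive definite with all eigenvalues `> ε > 0`, `lam > 0`,
and `Sighat k` symmetric with `|(Sighat k)ᵢⱼ − (Sig0)ᵢⱼ| ≤ lam` for all entries and `k`.
With `s₀` the number of nonzero off-diagonal entries of `Sig0` and
`F(Δ) = (1/(2M)) ∑ k ‖Δ + Sig0 − Sighat k‖²_F + lam |Δ + Sig0|₁`, for every symmetric
`Δ` with `Δ + Sig0 ⪰ εI` one has
`F(Δ) − F(0) ≥ (1/2)‖Δ‖²_F − 2 lam √(s₀ + p) ‖Δ‖_F`. -/
theorem ensemble_objective_lower_bound {p M : ℕ} (hM : 0 < M)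
    (Sig0 : Matrix (Fin p) (Fin p) ℝ) (hSig0 : Sig0.PosDef)
    (ε : ℝ) (hε : 0 < ε) (hεmin : ∀ i : Fin p, ε < hSig0.1.eigenvalues i)
    (lam : ℝ) (hlam : 0 < lam)
    (Sighat : Fin M → Matrix (Fin p) (Fin p) ℝ)
    (hsymm : ∀ k, (Sighat k).IsSymm)
    (hclose : ∀ (k : Fin M) (i j : Fin p), |Sighat k i j - Sig0 i j| ≤ lam) :
    let s0 : ℕ := offDiagSupport Sig0
    let F : Matrix (Fin p) (Fin p) ℝ → ℝ := fun Δ =>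
      (1 / (2 * (M : ℝ))) * ∑ k, (frobNorm (Δ + Sig0 - Sighat k)) ^ 2 +
        lam * offDiagL1 (Δ + Sig0)
    ∀ Δ : Matrix (Fin p) (Fin p) ℝ, Δ.IsSymm →
      (Δ + Sig0 - ε • (1 : Matrix (Fin p) (Fin p) ℝ)).PosSemidef →
      F Δ - F 0 ≥
        (1 / 2) * (frobNorm Δ) ^ 2 -
          2 * lam * Real.sqrt ((s0 : ℝ) + (p : ℝ)) * frobNorm Δ := by
  intro s0 F Δ _ _
  have hMR : (0 : ℝ) < M := by exact_mod_cast hM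
  have hs : ∑ k : Fin M, (frobNorm Δ ^ 2 - 4 * lam * ∑ x ∈ suppSet Sig0, |Δ x.1 x.2|) ≤
      ∑ k : Fin M, (frobNorm (Δ + Sig0 - Sighat k) ^ 2 - frobNorm (0 + Sig0 - Sighat k) ^ 2 +
        2 * lam * (offDiagL1 (Δ + Sig0) - offDiagL1 (0 + Sig0))) :=
    Finset.sum_le_sum fun k _ => one_term Sig0 Δ (Sighat k) lam hlam (hclose k)
  rw [Finset.sum_const, Finset.sum_add_distrib, Finset.sum_sub_distrib, Finset.sum_const,
    Finset.card_univ, Fintype.card_fin, nsmul_eq_mul, nsmul_eq_mul] at hs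
  have hcs := mul_le_mul_of_nonneg_left (sum_suppSet_le Sig0 Δ) hlam.le
  have h3 := mul_le_mul_of_nonneg_left hs (show 0 ≤ 1 / (2 * (M : ℝ)) by positivity)
  have e : ∀ y : ℝ, 1 / (2 * (M : ℝ)) * (M * y) = y / 2 := by
    intro y; field_simp
  rw [mul_add, e, e, mul_sub] at h3
  simp only [F, s0]
  linarith
end
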